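/- For any ring R, the following are equivalent: (1) l.Gwdim(R) = 0, i.e. every left R-module is Gorenstein flat; (2) R is IF, i.e. every injective left R-module and every injective right R-module is flat; (3) r.Gwdim(R) = 0, i.e. every right R-module is Gorenstein flat. -/

import Mathlib

/-!
Background definitions for D. Bennis, "Weak Gorenstein global dimensions".

Conventions.  All rings are associative with identity.  A *left* `R`-module is a type with
`[AddCommGroup M] [Module R M]`; a *right* `R`-module is a left module over the opposite ring,
i.e. `[Module Rᵐᵒᵖ M]`.  All "right-handed" notions below are obtained by applying the
corresponding "left-handed" notion to the opposite ring `Rᵐᵒᵖ`.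
-/

open MulOpposite

universe u

section Tensor

variable (S : Type u) [Ring S]

/-- The subgroup of relations defining the tensor product `A ⊗_S M` of a right `S`-module `A`
and a left `S`-module `M` over a (possibly noncommutative) ring `S`. -/
def tensorRels (A : Type u) [AddCommGroup A] [Module Sᵐᵒᵖ A]
    (M : Type u) [AddCommGroup M] [Module S M] :
    AddSubgroup (FreeAbelianGroup (A × M)) :=
  AddSubgroup.closure
    { x | (∃ a₁ a₂ m, x = FreeAbelianGroup.of (a₁ + a₂, m) - FreeAbelianGroup.of (a₁, m) -
            FreeAbelianGroup.of (a₂, m)) ∨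
          (∃ a m₁ m₂, x = FreeAbelianGroup.of (a, m₁ + m₂) - FreeAbelianGroup.of (a, m₁) -
            FreeAbelianGroup.of (a, m₂)) ∨
          (∃ (a : A) (r : S) (m : M), x = FreeAbelianGroup.of (op r • a, m) - FreeAbelianGroup.of (a, r • m)) }

/-- The tensor product `A ⊗_S M` (an abelian group) of a right `S`-module `A` and a left
`S`-module `M` over a (possibly noncommutative) ring `S`. -/
def NTensor (A : Type u) [AddCommGroup A] [Module Sᵐᵒᵖ A]
    (M : Type u) [AddCommGroup M] [Module S M] : Type u :=
  FreeAbelianGroup (A × M) ⧸ tensorRels S A M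

instance (A : Type u) [AddCommGroup A] [Module Sᵐᵒᵖ A]
    (M : Type u) [AddCommGroup M] [Module S M] : AddCommGroup (NTensor S A M) :=
  QuotientAddGroup.Quotient.addCommGroup _

namespace NTensor

variable {S}
variable {A A' : Type u} [AddCommGroup A] [Module Sᵐᵒᵖ A] [AddCommGroup A'] [Module Sᵐᵒᵖ A']
variable {M M' : Type u} [AddCommGroup M] [Module S M] [AddCommGroup M'] [Module S M']

/-- Functoriality of `A ⊗_S −` : the map `A ⊗_S M → A ⊗_S M'` induced by a linear map
`g : M → M'` of left `S`-modules. -/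
def rmap (A : Type u) [AddCommGroup A] [Module Sᵐᵒᵖ A] (g : M →ₗ[S] M') :
    NTensor S A M →+ NTensor S A M' :=
  QuotientAddGroup.map (tensorRels S A M) (tensorRels S A M') (FreeAbelianGroup.map (Prod.map id g)) (by
    simp only [tensorRels]
    refine (AddSubgroup.closure_le _).2 ?_
    rintro x (⟨a₁, a₂, m, rfl⟩ | ⟨a, m₁, m₂, rfl⟩ | ⟨a, r, m, rfl⟩) <;>
      refine SetLike.mem_coe.2 (AddSubgroup.mem_comap.2 (AddSubgroup.subset_closure ?_)) <;>
      simp only [map_sub, map_add, map_smul, FreeAbelianGroup.map_of_apply, Prod.map_apply,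
        id_eq, Set.mem_setOf_eq]
    · exact Or.inl ⟨a₁, a₂, g m, rfl⟩
    · exact Or.inr (Or.inl ⟨a, g m₁, g m₂, rfl⟩)
    · exact Or.inr (Or.inr ⟨a, r, g m, rfl⟩))

/-- Functoriality of `− ⊗_S M` : the map `A ⊗_S M → A' ⊗_S M` induced by a linear map
`f : A → A'` of right `S`-modules. -/
def lmap (M : Type u) [AddCommGroup M] [Module S M] (f : A →ₗ[Sᵐᵒᵖ] A') :
    NTensor S A M →+ NTensor S A' M :=
  QuotientAddGroup.map (tensorRels S A M) (tensorRels S A' M) (FreeAbelianGroup.map (Prod.map f id)) (by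
    simp only [tensorRels]
    refine (AddSubgroup.closure_le _).2 ?_
    rintro x (⟨a₁, a₂, m, rfl⟩ | ⟨a, m₁, m₂, rfl⟩ | ⟨a, r, m, rfl⟩) <;>
      refine SetLike.mem_coe.2 (AddSubgroup.mem_comap.2 (AddSubgroup.subset_closure ?_)) <;>
      simp only [map_sub, map_add, map_smul, FreeAbelianGroup.map_of_apply, Prod.map_apply,
        id_eq, Set.mem_setOf_eq]
    · exact Or.inl ⟨f a₁, f a₂, m, rfl⟩
    · exact Or.inr (Or.inl ⟨f a, m₁, m₂, rfl⟩)
    · exact Or.inr (Or.inr ⟨f a, r, m, rfl⟩))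

end NTensor

end Tensor

section Dims

variable (S : Type u) [Ring S]

/-- A left `S`-module `M` is *flat* if tensoring with it preserves injectivity of maps of
right `S`-modules. -/
def IsFlatMod (M : ModuleCat.{u} S) : Prop :=
  ∀ (A B : Type u) [AddCommGroup A] [Module Sᵐᵒᵖ A] [AddCommGroup B] [Module Sᵐᵒᵖ B]
    (f : A →ₗ[Sᵐᵒᵖ] B), Function.Injective f →
      Function.Injective (NTensor.lmap (↥M) f)

/-- A left `S`-module `M` is *Gorenstein flat* if there is an exact sequence
`⋯ → F (-1) → F 0 → F 1 → ⋯` of flat left `S`-modules with `M ≅ Im (F 0 → F 1)` which stays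
exact after applying `I ⊗_S −` for every injective right `S`-module `I`
(a *complete flat resolution*). -/
def IsGorensteinFlat (M : ModuleCat.{u} S) : Prop :=
  ∃ (F : ℤ → ModuleCat.{u} S) (d : ∀ n : ℤ, ↥(F n) →ₗ[S] ↥(F (n + 1))),
    (∀ n, IsFlatMod S (F n)) ∧
    (∀ n, Function.Exact (d n) (d (n + 1))) ∧
    Nonempty (↥M ≃ₗ[S] ↥(LinearMap.range (d 0))) ∧
    (∀ (I : Type u) [AddCommGroup I] [Module Sᵐᵒᵖ I], Module.Injective Sᵐᵒᵖ I →
      ∀ n, Function.Exact (NTensor.rmap I (d n)) (NTensor.rmap I (d (n + 1))))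

/-- `gflatDimLE S n M` means `Gfd_S(M) ≤ n`: there is an exact sequence
`0 → G_n → ⋯ → G_0 → M → 0` of left `S`-modules with all `G_i` Gorenstein flat. -/
def gflatDimLE : ℕ → ModuleCat.{u} S → Prop
  | 0, M => IsGorensteinFlat S M
  | n + 1, M => ∃ (K G : ModuleCat.{u} S) (ι : ↥K →ₗ[S] ↥G) (π : ↥G →ₗ[S] ↥M),
      Function.Injective ι ∧ Function.Surjective π ∧ Function.Exact ι π ∧
      IsGorensteinFlat S G ∧ gflatDimLE n K

/-- `flatDimLE S n M` means `fd_S(M) ≤ n`: there is an exact sequence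
`0 → F_n → ⋯ → F_0 → M → 0` of left `S`-modules with all `F_i` flat. -/
def flatDimLE : ℕ → ModuleCat.{u} S → Prop
  | 0, M => IsFlatMod S M
  | n + 1, M => ∃ (K F : ModuleCat.{u} S) (ι : ↥K →ₗ[S] ↥F) (π : ↥F →ₗ[S] ↥M),
      Function.Injective ι ∧ Function.Surjective π ∧ Function.Exact ι π ∧
      IsFlatMod S F ∧ flatDimLE n K

/-- `injDimLE S n M` means `id_S(M) ≤ n`: there is an exact sequence
`0 → M → I^0 → ⋯ → I^n → 0` of left `S`-modules with all `I^i` injective. -/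
def injDimLE : ℕ → ModuleCat.{u} S → Prop
  | 0, M => Module.Injective S ↥M
  | n + 1, M => ∃ (I C : ModuleCat.{u} S) (ι : ↥M →ₗ[S] ↥I) (π : ↥I →ₗ[S] ↥C),
      Function.Injective ι ∧ Function.Surjective π ∧ Function.Exact ι π ∧
      Module.Injective S ↥I ∧ injDimLE n C

/-- The Gorenstein flat dimension `Gfd_S(M) ∈ ℕ∞` of a left `S`-module `M`. -/
noncomputable def gflatDim (M : ModuleCat.{u} S) : ℕ∞ :=
  sInf {d : ℕ∞ | ∃ n : ℕ, d = n ∧ gflatDimLE S n M}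

/-- The flat dimension `fd_S(M) ∈ ℕ∞` of a left `S`-module `M`. -/
noncomputable def flatDim (M : ModuleCat.{u} S) : ℕ∞ :=
  sInf {d : ℕ∞ | ∃ n : ℕ, d = n ∧ flatDimLE S n M}

/-- The injective dimension `id_S(M) ∈ ℕ∞` of a left `S`-module `M`. -/
noncomputable def injDim (M : ModuleCat.{u} S) : ℕ∞ :=
  sInf {d : ℕ∞ | ∃ n : ℕ, d = n ∧ injDimLE S n M}

/-- The left weak Gorenstein global dimension
`l.Gwdim(S) = sup { Gfd_S(M) | M a left S-module }`.  The right weak Gorenstein global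
dimension of `S` is `gorensteinWeakGlobalDim Sᵐᵒᵖ`. -/
noncomputable def gorensteinWeakGlobalDim : ℕ∞ :=
  ⨆ M : ModuleCat.{u} S, gflatDim S M

/-- The left weak global dimension `sup { fd_S(M) | M a left S-module }`.  (By a classical
theorem it agrees with `weakGlobalDim Sᵐᵒᵖ`, and the common value is `wdim S`.) -/
noncomputable def weakGlobalDim : ℕ∞ :=
  ⨆ M : ModuleCat.{u} S, flatDim S M

/-- The left finitistic flat dimension
`l.FFD(S) = sup { fd_S(M) | M a left S-module with fd_S(M) < ∞ }`. -/
noncomputable def finitisticFlatDim : ℕ∞ :=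
  sSup {d : ℕ∞ | d ≠ ⊤ ∧ ∃ M : ModuleCat.{u} S, flatDim S M = d}

/-- The left finitistic Gorenstein flat dimension
`l.FGFD(S) = sup { Gfd_S(M) | M a left S-module with Gfd_S(M) < ∞ }`. -/
noncomputable def finitisticGFlatDim : ℕ∞ :=
  sSup {d : ℕ∞ | d ≠ ⊤ ∧ ∃ M : ModuleCat.{u} S, gflatDim S M = d}

/-- A ring `S` is *left GF-closed* if the class of Gorenstein flat left `S`-modules is closed
under extensions.  `S` is right GF-closed iff `Sᵐᵒᵖ` is left GF-closed, and GF-closed if both. -/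
def IsGFClosed : Prop :=
  ∀ (A B C : ModuleCat.{u} S) (f : ↥A →ₗ[S] ↥B) (g : ↥B →ₗ[S] ↥C),
    Function.Injective f → Function.Surjective g → Function.Exact f g →
      IsGorensteinFlat S A → IsGorensteinFlat S C → IsGorensteinFlat S B

/-- A ring `S` is *left coherent* if every finitely generated left ideal of `S` is finitely
presented (as a left `S`-module).  `S` is right coherent iff `Sᵐᵒᵖ` is left coherent. -/
def IsLeftCoherent : Prop :=
  ∀ I : Submodule S S, I.FG → Module.FinitePresentation S ↥I

/-- A ring `S` is *left IF* if every injective left `S`-module is flat.  `S` is right IF iff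
`Sᵐᵒᵖ` is left IF, and IF if both. -/
def IsLeftIF : Prop :=
  ∀ E : ModuleCat.{u} S, Module.Injective S ↥E → IsFlatMod S E

/-- A ring `S` is *left `n`-IF* if `fd_S(E) ≤ n` for every injective left `S`-module `E`.
`S` is right `n`-IF iff `Sᵐᵒᵖ` is left `n`-IF, and `n`-IF if both. -/
def IsLeftNIF (n : ℕ) : Prop :=
  ∀ E : ModuleCat.{u} S, Module.Injective S ↥E → flatDim S E ≤ (n : ℕ∞)

/-- `Ext¹_S(T, K) = 0`, expressed by its standard characterization: every extension of `T`
by `K` (i.e. every short exact sequence `0 → K → X → T → 0`) splits. -/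
def Ext1Zero (T K : ModuleCat.{u} S) : Prop :=
  ∀ (X : ModuleCat.{u} S) (ι : ↥K →ₗ[S] ↥X) (π : ↥X →ₗ[S] ↥T),
    Function.Injective ι → Function.Surjective π → Function.Exact ι π →
      ∃ ρ : ↥X →ₗ[S] ↥K, ρ.comp ι = LinearMap.id

/-- A left `S`-module `K` is *cotorsion* if `Ext¹_S(F, K) = 0` for every flat left
`S`-module `F`. -/
def IsCotorsion (K : ModuleCat.{u} S) : Prop :=
  ∀ F : ModuleCat.{u} S, IsFlatMod S F → Ext1Zero S F K

/-- `Tor₁^S(A, T) = 0` for a right `S`-module `A` and a left `S`-module `T`, expressed by its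
standard characterization: for every short exact sequence `0 → K → F → T → 0` of left
`S`-modules with `F` flat, the induced map `A ⊗_S K → A ⊗_S F` is injective. -/
def Tor1Zero (A : Type u) [AddCommGroup A] [Module Sᵐᵒᵖ A] (T : ModuleCat.{u} S) : Prop :=
  ∀ (K F : ModuleCat.{u} S) (ι : ↥K →ₗ[S] ↥F) (π : ↥F →ₗ[S] ↥T),
    IsFlatMod S F → Function.Injective ι → Function.Surjective π → Function.Exact ι π →
      Function.Injective (NTensor.rmap A ι)

/-- A left `S`-module is *finitely presented* if it admits a presentation with finitely many
generators and relations. -/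
abbrev IsFinitelyPresented (M : ModuleCat.{u} S) : Prop :=
  Module.FinitePresentation S ↥M

end Dims

namespace NTensor

section Basic

variable {S : Type u} [Ring S]
variable {A A' : Type u} [AddCommGroup A] [Module Sᵐᵒᵖ A] [AddCommGroup A'] [Module Sᵐᵒᵖ A']
variable {M M' M'' : Type u} [AddCommGroup M] [Module S M] [AddCommGroup M'] [Module S M']
  [AddCommGroup M''] [Module S M'']

variable (S A M) in
/-- The quotient map presenting `A ⊗_S M`. -/
def mk : FreeAbelianGroup (A × M) →+ NTensor S A M :=
  QuotientAddGroup.mk' (tensorRels S A M)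

lemma mk_eq_of_sub_mem {x y : FreeAbelianGroup (A × M)} (h : x - y ∈ tensorRels S A M) :
    mk S A M x = mk S A M y := by
  rw [← sub_eq_zero, ← map_sub]
  exact (QuotientAddGroup.eq_zero_iff _).2 h

variable (S) in
/-- The elementary tensor `a ⊗ m`. -/
def tmul (a : A) (m : M) : NTensor S A M :=
  mk S A M (FreeAbelianGroup.of (a, m))

lemma add_tmul (a₁ a₂ : A) (m : M) : tmul S (a₁ + a₂) m = tmul S a₁ m + tmul S a₂ m := by
  rw [tmul, tmul, tmul, ← map_add]
  refine mk_eq_of_sub_mem (AddSubgroup.subset_closure (Or.inl ⟨a₁, a₂, m, ?_⟩))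
  abel

lemma tmul_add (a : A) (m₁ m₂ : M) : tmul S a (m₁ + m₂) = tmul S a m₁ + tmul S a m₂ := by
  rw [tmul, tmul, tmul, ← map_add]
  refine mk_eq_of_sub_mem (AddSubgroup.subset_closure (Or.inr (Or.inl ⟨a, m₁, m₂, ?_⟩)))
  abel

lemma smul_tmul (a : A) (r : S) (m : M) : tmul S (op r • a) m = tmul S a (r • m) :=
  mk_eq_of_sub_mem (AddSubgroup.subset_closure (Or.inr (Or.inr ⟨a, r, m, rfl⟩)))

variable (S A M) in
/-- The universal balanced biadditive map `A × M → A ⊗_S M`. -/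
def tmulHom : A →+ M →+ NTensor S A M :=
  AddMonoidHom.mk' (fun a => AddMonoidHom.mk' (tmul S a) (tmul_add a))
    fun a₁ a₂ => AddMonoidHom.ext fun m => add_tmul a₁ a₂ m

@[simp] lemma tmulHom_apply (a : A) (m : M) : tmulHom S A M a m = tmul S a m := rfl

/-- The additive map out of `A ⊗_S M` induced by a balanced biadditive map. -/
def lift {G : Type*} [AddCommGroup G] (φ : A →+ M →+ G)
    (h : ∀ (a : A) (r : S) (m : M), φ (op r • a) m = φ a (r • m)) : NTensor S A M →+ G :=
  QuotientAddGroup.lift _ (FreeAbelianGroup.lift fun p : A × M => φ p.1 p.2) (by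
    simp only [tensorRels]
    refine (AddSubgroup.closure_le _).2 ?_
    rintro x (⟨a₁, a₂, m, rfl⟩ | ⟨a, m₁, m₂, rfl⟩ | ⟨a, r, m, rfl⟩) <;>
      simp [h])

@[simp] lemma lift_tmul {G : Type*} [AddCommGroup G] (φ : A →+ M →+ G)
    (h : ∀ (a : A) (r : S) (m : M), φ (op r • a) m = φ a (r • m)) (a : A) (m : M) :
    lift φ h (tmul S a m) = φ a m :=
  FreeAbelianGroup.lift_apply_of _ _

lemma addHom_ext {G : Type*} [AddCommGroup G] {f g : NTensor S A M →+ G}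
    (h : ∀ a m, f (tmul S a m) = g (tmul S a m)) : f = g := by
  refine QuotientAddGroup.addMonoidHom_ext _ (FreeAbelianGroup.lift_ext _ _ fun p => ?_)
  exact h p.1 p.2

@[simp] lemma rmap_tmul (g : M →ₗ[S] M') (a : A) (m : M) :
    rmap A g (tmul S a m) = tmul S a (g m) := rfl

@[simp] lemma lmap_tmul (f : A →ₗ[Sᵐᵒᵖ] A') (a : A) (m : M) :
    lmap M f (tmul S a m) = tmul S (f a) m := rfl

lemma rmap_comp (g : M →ₗ[S] M') (g' : M' →ₗ[S] M'') (x : NTensor S A M) :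
    rmap A (g' ∘ₗ g) x = rmap A g' (rmap A g x) :=
  DFunLike.congr_fun (addHom_ext (f := rmap A (g' ∘ₗ g)) (g := (rmap A g').comp (rmap A g))
    fun _ _ => rfl) x

lemma rmap_id (x : NTensor S A M) : rmap A (LinearMap.id : M →ₗ[S] M) x = x :=
  DFunLike.congr_fun (addHom_ext (f := rmap A (LinearMap.id : M →ₗ[S] M))
    (g := AddMonoidHom.id _) fun _ _ => rfl) x

lemma lmap_rmap (f : A →ₗ[Sᵐᵒᵖ] A') (g : M →ₗ[S] M') (x : NTensor S A M) :
    lmap M' f (rmap A g x) = rmap A' g (lmap M f x) :=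
  DFunLike.congr_fun (addHom_ext (f := (lmap M' f).comp (rmap A g))
    (g := (rmap A' g).comp (lmap M f)) fun _ _ => rfl) x

lemma closure_range_tmul :
    AddSubgroup.closure {x : NTensor S A M | ∃ a m, x = tmul S a m} = ⊤ := by
  rw [← QuotientAddGroup.ker_mk' (AddSubgroup.closure _), AddMonoidHom.ker_eq_top_iff]
  refine addHom_ext fun a m => ?_
  exact (QuotientAddGroup.eq_zero_iff _).2 (AddSubgroup.subset_closure ⟨a, m, rfl⟩)

lemma rmap_surjective {g : M →ₗ[S] M'} (hg : Function.Surjective g) :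
    Function.Surjective (rmap A g) := by
  rw [← AddMonoidHom.range_eq_top, ← top_le_iff, ← closure_range_tmul, AddSubgroup.closure_le]
  rintro _ ⟨a, m, rfl⟩
  obtain ⟨m, rfl⟩ := hg m
  exact ⟨tmul S a m, rfl⟩

/-- Right exactness of `A ⊗_S −`. -/
lemma rmap_exact {f : M →ₗ[S] M'} {g : M' →ₗ[S] M''} (hfg : Function.Exact f g)
    (hg : Function.Surjective g) : Function.Exact (rmap A f) (rmap A g) := by
  let Q := NTensor S A M' ⧸ (rmap A f).range
  let q : NTensor S A M' →+ Q := QuotientAddGroup.mk' _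
  have hq : ∀ (a : A) (m₁ m₂ : M'), g m₁ = g m₂ → q (tmul S a m₁) = q (tmul S a m₂) := by
    intro a m₁ m₂ h
    obtain ⟨k, hk⟩ := (hfg (m₁ - m₂)).1 (by rw [map_sub, h, sub_self])
    have : tmul S a m₁ = rmap A f (tmul S a k) + tmul S a m₂ := by
      rw [rmap_tmul, hk, ← tmul_add, sub_add_cancel]
    rw [this, map_add, add_eq_right]
    exact (QuotientAddGroup.eq_zero_iff _).2 ⟨_, rfl⟩
  let s := Function.surjInv hg
  have hs : ∀ n, g (s n) = n := Function.surjInv_eq hg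
  let ψ : NTensor S A M'' →+ Q := lift
    (AddMonoidHom.mk' (fun a => AddMonoidHom.mk' (fun n => q (tmul S a (s n)))
        fun n₁ n₂ => by
          rw [← map_add, ← tmul_add]
          exact hq _ _ _ (by simp only [map_add, hs]))
      fun a₁ a₂ => AddMonoidHom.ext fun n => by simp [add_tmul])
    fun a r n => by
      simp only [AddMonoidHom.mk'_apply, smul_tmul]
      exact hq _ _ _ (by simp only [map_smul, hs])
  have hψ : ψ.comp (rmap A g) = q := addHom_ext fun a m => by
    simp only [AddMonoidHom.comp_apply, rmap_tmul, ψ, lift_tmul]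
    exact hq _ _ _ (hs _)
  intro x
  constructor
  · intro hx
    have : q x = 0 := by rw [← hψ, AddMonoidHom.comp_apply, hx, map_zero]
    exact (QuotientAddGroup.eq_zero_iff _).1 this
  · rintro ⟨y, rfl⟩
    rw [← rmap_comp, hfg.linearMap_comp_eq_zero]
    have : rmap A (0 : M →ₗ[S] M'') = 0 := addHom_ext fun a m => by
      simpa using (tmulHom S A M'' a).map_zero
    rw [this, AddMonoidHom.zero_apply]

end Basic

section Swap

variable {S : Type u} [Ring S]
variable {A A' : Type u} [AddCommGroup A] [Module Sᵐᵒᵖ A] [AddCommGroup A'] [Module Sᵐᵒᵖ A']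
variable {M M' : Type u} [AddCommGroup M] [Module S M] [AddCommGroup M'] [Module S M']
variable [Module Sᵐᵒᵖᵐᵒᵖ M'] [Module Sᵐᵒᵖᵐᵒᵖ M]

/-- The map `A ⊗_S M → M ⊗_{Sᵐᵒᵖ} A`, `a ⊗ m ↦ m ⊗ a`. -/
def swapHom (h : ∀ (r : S) (m : M), op (op r) • m = r • m) :
    NTensor S A M →+ NTensor Sᵐᵒᵖ M A :=
  lift (tmulHom Sᵐᵒᵖ M A).flip fun a r m =>
    (smul_tmul m (op r) a).symm.trans (congrArg (fun x => tmul Sᵐᵒᵖ x a) (h r m))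

/-- The map `M ⊗_{Sᵐᵒᵖ} A → A ⊗_S M`, `m ⊗ a ↦ a ⊗ m`. -/
def swapInvHom (h : ∀ (r : S) (m : M), op (op r) • m = r • m) :
    NTensor Sᵐᵒᵖ M A →+ NTensor S A M :=
  lift (tmulHom S A M).flip fun m r a =>
    (congrArg (tmul S a) (h r.unop m)).trans (smul_tmul a r.unop m).symm

lemma swapHom_tmul (h : ∀ (r : S) (m : M), op (op r) • m = r • m) (a : A) (m : M) :
    swapHom h (tmul S a m) = tmul Sᵐᵒᵖ m a := lift_tmul _ _ a m

lemma swapInvHom_tmul (h : ∀ (r : S) (m : M), op (op r) • m = r • m) (a : A) (m : M) :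
    swapInvHom h (tmul Sᵐᵒᵖ m a) = tmul S a m := lift_tmul _ _ m a

/-- The symmetry `A ⊗_S M ≃ M ⊗_{Sᵐᵒᵖ} A`. -/
def swap (h : ∀ (r : S) (m : M), op (op r) • m = r • m) :
    NTensor S A M ≃+ NTensor Sᵐᵒᵖ M A :=
  AddMonoidHom.toAddEquiv (swapHom h) (swapInvHom h)
    (addHom_ext fun _ _ => by simp [swapHom_tmul, swapInvHom_tmul])
    (addHom_ext fun _ _ => by simp [swapHom_tmul, swapInvHom_tmul])

@[simp] lemma swap_tmul (h : ∀ (r : S) (m : M), op (op r) • m = r • m) (a : A) (m : M) :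
    swap h (tmul S a m) = tmul Sᵐᵒᵖ m a := swapHom_tmul h a m

lemma swap_lmap (h : ∀ (r : S) (m : M), op (op r) • m = r • m) (f : A →ₗ[Sᵐᵒᵖ] A')
    (x : NTensor S A M) : swap h (lmap M f x) = rmap M f (swap h x) :=
  DFunLike.congr_fun (addHom_ext (f := (swap h).toAddMonoidHom.comp (lmap M f))
    (g := (rmap M f).comp (swap h).toAddMonoidHom) fun _ _ => by simp) x

lemma swap_rmap (h : ∀ (r : S) (m : M), op (op r) • m = r • m)
    (h' : ∀ (r : S) (m : M'), op (op r) • m = r • m) (g : M →ₗ[S] M')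
    (g' : M →ₗ[Sᵐᵒᵖᵐᵒᵖ] M') (hg : ∀ m, g' m = g m) (x : NTensor S A M) :
    swap h' (rmap A g x) = lmap A g' (swap h x) :=
  DFunLike.congr_fun (addHom_ext (f := (swap h').toAddMonoidHom.comp (rmap A g))
    (g := (lmap A g').comp (swap h).toAddMonoidHom) fun _ _ => by simp [hg]) x

end Swap

end NTensor

section OpOp

variable (S : Type u) [Ring S]

/-- A left `S`-module, seen as a left module over `Sᵐᵒᵖᵐᵒᵖ`. -/
abbrev moduleOpOp (M : Type u) [AddCommGroup M] [Module S M] : Module Sᵐᵒᵖᵐᵒᵖ M :=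
  Module.compHom M (RingEquiv.opOp S).symm.toRingHom

/-- A left `Sᵐᵒᵖᵐᵒᵖ`-module, seen as a left module over `S`. -/
abbrev moduleOfOpOp (M : Type u) [AddCommGroup M] [Module Sᵐᵒᵖᵐᵒᵖ M] : Module S M :=
  Module.compHom M (RingEquiv.opOp S).toRingHom

variable {S}

/-- An additive map linear over `S` is linear over `Sᵐᵒᵖᵐᵒᵖ`. -/
def LinearMap.toOpOp {M N : Type u} [AddCommGroup M] [AddCommGroup N] [Module S M] [Module S N]
    [Module Sᵐᵒᵖᵐᵒᵖ M] [Module Sᵐᵒᵖᵐᵒᵖ N] (hM : ∀ (r : S) (m : M), op (op r) • m = r • m)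
    (hN : ∀ (r : S) (m : N), op (op r) • m = r • m) (f : M →ₗ[S] N) : M →ₗ[Sᵐᵒᵖᵐᵒᵖ] N where
  __ := f.toAddMonoidHom
  map_smul' r m := (congrArg f (hM r.unop.unop m)).trans
    ((f.map_smul _ _).trans (hN r.unop.unop (f m)).symm)

/-- An additive map linear over `Sᵐᵒᵖᵐᵒᵖ` is linear over `S`. -/
def LinearMap.ofOpOp {M N : Type u} [AddCommGroup M] [AddCommGroup N] [Module S M] [Module S N]
    [Module Sᵐᵒᵖᵐᵒᵖ M] [Module Sᵐᵒᵖᵐᵒᵖ N] (hM : ∀ (r : S) (m : M), op (op r) • m = r • m)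
    (hN : ∀ (r : S) (m : N), op (op r) • m = r • m) (f : M →ₗ[Sᵐᵒᵖᵐᵒᵖ] N) : M →ₗ[S] N where
  __ := f.toAddMonoidHom
  map_smul' r m := (congrArg f (hM r m).symm).trans ((f.map_smul _ _).trans (hN r (f m)))

lemma injective_opOp_iff {M : Type u} [AddCommGroup M] [Module S M] [Module Sᵐᵒᵖᵐᵒᵖ M]
    (hM : ∀ (r : S) (m : M), op (op r) • m = r • m) :
    Module.Injective Sᵐᵒᵖᵐᵒᵖ M ↔ Module.Injective S M := by
  constructor
  · refine fun hi => ⟨fun X Y _ _ _ _ f hf g => ?_⟩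
    let _ := moduleOpOp S X
    let _ := moduleOpOp S Y
    obtain ⟨k, hk⟩ := hi.out (f.toOpOp (fun _ _ => rfl) fun _ _ => rfl) hf
      (g.toOpOp (fun _ _ => rfl) hM)
    exact ⟨k.ofOpOp (fun _ _ => rfl) hM, hk⟩
  · refine fun hi => ⟨fun X Y _ _ _ _ f hf g => ?_⟩
    let _ := moduleOfOpOp S X
    let _ := moduleOfOpOp S Y
    obtain ⟨k, hk⟩ := hi.out (f.ofOpOp (fun _ _ => rfl) fun _ _ => rfl) hf
      (g.ofOpOp (fun _ _ => rfl) hM)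
    exact ⟨k.toOpOp (fun _ _ => rfl) hM, hk⟩

end OpOp

section Flat

variable {S : Type u} [Ring S]

/-- Right exactness of `− ⊗_S M`. -/
lemma NTensor.lmap_exact {A A' A'' M : Type u} [AddCommGroup A] [Module Sᵐᵒᵖ A] [AddCommGroup A']
    [Module Sᵐᵒᵖ A'] [AddCommGroup A''] [Module Sᵐᵒᵖ A''] [AddCommGroup M] [Module S M]
    {f : A →ₗ[Sᵐᵒᵖ] A'} {g : A' →ₗ[Sᵐᵒᵖ] A''} (hfg : Function.Exact f g)
    (hg : Function.Surjective g) : Function.Exact (lmap M f) (lmap M g) := by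
  let _ := moduleOpOp S M
  have h : ∀ (r : S) (m : M), op (op r) • m = r • m := fun _ _ => rfl
  intro x
  rw [← (swap h).map_eq_zero_iff, swap_lmap, NTensor.rmap_exact hfg hg]
  constructor
  · rintro ⟨y, hy⟩
    refine ⟨(swap h).symm y, (swap h).injective ?_⟩
    rw [swap_lmap, AddEquiv.apply_symm_apply, hy]
  · rintro ⟨y, rfl⟩
    exact ⟨swap h y, (swap_lmap h f y).symm⟩

lemma NTensor.lmap_surjective {A A' M : Type u} [AddCommGroup A] [Module Sᵐᵒᵖ A] [AddCommGroup A']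
    [Module Sᵐᵒᵖ A'] [AddCommGroup M] [Module S M] {f : A →ₗ[Sᵐᵒᵖ] A'}
    (hf : Function.Surjective f) : Function.Surjective (lmap M f) := by
  rw [← AddMonoidHom.range_eq_top, ← top_le_iff, ← closure_range_tmul, AddSubgroup.closure_le]
  rintro _ ⟨a, m, rfl⟩
  obtain ⟨a, rfl⟩ := hf a
  exact ⟨tmul S a m, rfl⟩

variable (S) in
/-- A right `S`-module `A` is flat if `A ⊗_S −` preserves injectivity. -/
def IsRightFlat (A : Type u) [AddCommGroup A] [Module Sᵐᵒᵖ A] : Prop :=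
  ∀ (M N : Type u) [AddCommGroup M] [Module S M] [AddCommGroup N] [Module S N]
    (g : M →ₗ[S] N), Function.Injective g → Function.Injective (NTensor.rmap A g)

/-- A left module is flat over `S` iff it is flat as a right module over `Sᵐᵒᵖ`. -/
lemma isFlatMod_iff_isRightFlat {M : Type u} [AddCommGroup M] [Module S M] [Module Sᵐᵒᵖᵐᵒᵖ M]
    (h : ∀ (r : S) (m : M), op (op r) • m = r • m) :
    IsFlatMod S (ModuleCat.of S M) ↔ IsRightFlat Sᵐᵒᵖ M := by
  have key : ∀ {A B : Type u} [AddCommGroup A] [Module Sᵐᵒᵖ A] [AddCommGroup B] [Module Sᵐᵒᵖ B]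
      (f : A →ₗ[Sᵐᵒᵖ] B), Function.Injective (NTensor.lmap M f) ↔
        Function.Injective (NTensor.rmap (S := Sᵐᵒᵖ) M f) := by
    intro A B _ _ _ _ f
    have : (NTensor.swap h) ∘ (NTensor.lmap M f) = (NTensor.rmap M f) ∘ (NTensor.swap h) :=
      funext fun x => NTensor.swap_lmap h f x
    rw [← (NTensor.swap h (A := B)).injective.of_comp_iff, this,
      EquivLike.injective_comp]
  exact ⟨fun H A B _ _ _ _ f hf => (key f).1 (H A B f hf),
    fun H A B _ _ _ _ f hf => (key f).2 (H A B f hf)⟩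

/-- A left `Sᵐᵒᵖ`-module is flat iff it is flat as a right `S`-module. -/
lemma isFlatMod_op_iff (A : Type u) [AddCommGroup A] [Module Sᵐᵒᵖ A] :
    IsFlatMod Sᵐᵒᵖ (ModuleCat.of Sᵐᵒᵖ A) ↔ IsRightFlat S A := by
  have key : ∀ {M N : Type u} [AddCommGroup M] [Module S M] [AddCommGroup N] [Module S N]
      [Module Sᵐᵒᵖᵐᵒᵖ M] [Module Sᵐᵒᵖᵐᵒᵖ N] (hM : ∀ (r : S) (m : M), op (op r) • m = r • m)
      (hN : ∀ (r : S) (m : N), op (op r) • m = r • m) (g : M →ₗ[S] N) (g' : M →ₗ[Sᵐᵒᵖᵐᵒᵖ] N),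
      (∀ m, g' m = g m) → (Function.Injective (NTensor.rmap A g) ↔
        Function.Injective (NTensor.lmap (S := Sᵐᵒᵖ) A g')) := by
    intro M N _ _ _ _ _ _ hM hN g g' hg
    have : (NTensor.swap hN) ∘ (NTensor.rmap A g) = (NTensor.lmap A g') ∘ (NTensor.swap hM) :=
      funext fun x => NTensor.swap_rmap hM hN g g' hg x
    rw [← (NTensor.swap hN (A := A)).injective.of_comp_iff, this,
      EquivLike.injective_comp]
  constructor
  · intro H M N _ _ _ _ g hg
    let _ := moduleOpOp S M
    let _ := moduleOpOp S N
    exact (key (fun _ _ => rfl) (fun _ _ => rfl) g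
      (g.toOpOp (fun _ _ => rfl) fun _ _ => rfl) fun _ => rfl).2 (H M N _ hg)
  · intro H M N _ _ _ _ g hg
    let _ := moduleOfOpOp S M
    let _ := moduleOfOpOp S N
    exact (key (fun _ _ => rfl) (fun _ _ => rfl)
      (g.ofOpOp (fun _ _ => rfl) fun _ _ => rfl) g fun _ => rfl).1 (H M N _ hg)

lemma isLeftIF_opOp_iff : IsLeftIF Sᵐᵒᵖᵐᵒᵖ ↔ IsLeftIF S := by
  constructor
  · intro H E hE
    let _ := moduleOpOp S E
    have h : ∀ (r : S) (m : E), op (op r) • m = r • m := fun _ _ => rfl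
    exact (isFlatMod_iff_isRightFlat h).2
      ((isFlatMod_op_iff (S := Sᵐᵒᵖ) E).1 (H (.of _ E) ((injective_opOp_iff h).2 hE)))
  · intro H E hE
    let _ := moduleOfOpOp S E
    have h : ∀ (r : S) (m : E), op (op r) • m = r • m := fun _ _ => rfl
    exact (isFlatMod_op_iff (S := Sᵐᵒᵖ) E).2
      ((isFlatMod_iff_isRightFlat h).1 (H (.of _ E) ((injective_opOp_iff h).1 hE)))

lemma isLeftIF_op_iff : IsLeftIF Sᵐᵒᵖ ↔ ∀ (I : Type u) [AddCommGroup I] [Module Sᵐᵒᵖ I],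
    Module.Injective Sᵐᵒᵖ I → IsRightFlat S I :=
  ⟨fun H I _ _ hI => (isFlatMod_op_iff I).1 (H (.of _ I) hI),
    fun H E hE => (isFlatMod_op_iff E).2 (H E hE)⟩

/-- The map `A ⊗_S S^(ι) → A^(ι)`. -/
noncomputable def tensorFinsupp (A : Type u) [AddCommGroup A] [Module Sᵐᵒᵖ A] (ι : Type u) :
    NTensor S A (ι →₀ S) →+ (ι →₀ A) :=
  NTensor.lift
    (AddMonoidHom.mk' (fun a => Finsupp.mapRange.addMonoidHom
        (AddMonoidHom.mk' (fun s : S => op s • a) fun s t => by rw [op_add, add_smul]))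
      fun a b => by ext; simp)
    fun a r q => by ext; simp [mul_smul]

/-- The map `A^(ι) → A ⊗_S S^(ι)`. -/
noncomputable def finsuppTensor (A : Type u) [AddCommGroup A] [Module Sᵐᵒᵖ A] (ι : Type u) :
    (ι →₀ A) →+ NTensor S A (ι →₀ S) :=
  Finsupp.liftAddHom fun i => (NTensor.tmulHom S A (ι →₀ S)).flip (Finsupp.single i 1)

lemma finsuppTensor_tensorFinsupp (A : Type u) [AddCommGroup A] [Module Sᵐᵒᵖ A] (ι : Type u)
    (x : NTensor S A (ι →₀ S)) : finsuppTensor A ι (tensorFinsupp A ι x) = x := by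
  suffices h : (finsuppTensor A ι).comp (tensorFinsupp A ι) = AddMonoidHom.id _ from
    DFunLike.congr_fun h x
  refine NTensor.addHom_ext fun a q => ?_
  suffices h : (finsuppTensor A ι).comp ((tensorFinsupp A ι).comp (NTensor.tmulHom S A (ι →₀ S) a))
      = NTensor.tmulHom S A (ι →₀ S) a from DFunLike.congr_fun h q
  refine Finsupp.addHom_ext fun i s => ?_
  simp [tensorFinsupp, finsuppTensor, NTensor.smul_tmul]

lemma tensorFinsupp_lmap {A B : Type u} [AddCommGroup A] [Module Sᵐᵒᵖ A] [AddCommGroup B]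
    [Module Sᵐᵒᵖ B] (f : A →ₗ[Sᵐᵒᵖ] B) (ι : Type u) (x : NTensor S A (ι →₀ S)) :
    tensorFinsupp B ι (NTensor.lmap _ f x) = (tensorFinsupp A ι x).mapRange f f.map_zero := by
  suffices h : (tensorFinsupp B ι).comp (NTensor.lmap _ f) =
      (Finsupp.mapRange.addMonoidHom f.toAddMonoidHom).comp (tensorFinsupp A ι) from
    DFunLike.congr_fun h x
  refine NTensor.addHom_ext fun a q => ?_
  ext i
  simp [tensorFinsupp]

lemma isFlatMod_finsupp (ι : Type u) : IsFlatMod S (ModuleCat.of S (ι →₀ S)) := by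
  intro A B _ _ _ _ f hf x y hxy
  have h := congrArg (tensorFinsupp B ι) hxy
  refine (Function.LeftInverse.injective (finsuppTensor_tensorFinsupp A ι))
    (Finsupp.mapRange_injective f f.map_zero hf ?_)
  exact (tensorFinsupp_lmap f ι x).symm.trans (h.trans (tensorFinsupp_lmap f ι y))

/-- There is a short exact sequence `0 → X → F → Y → 0` with `F` flat. -/
def FlatLink (X Y : ModuleCat.{u} S) : Prop :=
  ∃ (F : ModuleCat.{u} S) (i : X →ₗ[S] F) (p : F →ₗ[S] Y),
    Function.Injective i ∧ Function.Exact i p ∧ Function.Surjective p ∧ IsFlatMod S F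

lemma exists_flatLink_left (Y : ModuleCat.{u} S) : ∃ X, FlatLink X Y := by
  let p : (Y →₀ S) →ₗ[S] Y := Finsupp.linearCombination S id
  exact ⟨.of S (LinearMap.ker p), .of S (Y →₀ S), (LinearMap.ker p).subtype, p,
    Subtype.val_injective, LinearMap.exact_subtype_ker_map p,
    Finsupp.linearCombination_id_surjective S Y, isFlatMod_finsupp _⟩

/-- A short exact sequence with flat cokernel is pure. -/
lemma rmap_injective_of_flat_cokernel (I : Type u) [AddCommGroup I] [Module Sᵐᵒᵖ I]
    {K P F : Type u} [AddCommGroup K] [Module S K] [AddCommGroup P] [Module S P]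
    [AddCommGroup F] [Module S F] {f : K →ₗ[S] P} {g : P →ₗ[S] F} (hf : Function.Injective f)
    (hfg : Function.Exact f g) (hg : Function.Surjective g)
    (hF : IsFlatMod S (ModuleCat.of S F)) : Function.Injective (NTensor.rmap I f) := by
  obtain ⟨J, Q, j, p, hj, hjp, hp, hQ⟩ := exists_flatLink_left (ModuleCat.of Sᵐᵒᵖ I)
  rw [injective_iff_map_eq_zero]
  intro x hx
  obtain ⟨x, rfl⟩ := NTensor.lmap_surjective hp x
  rw [← NTensor.lmap_rmap] at hx
  obtain ⟨z, hz⟩ := (NTensor.lmap_exact hjp hp _).1 hx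
  have hz0 : NTensor.rmap _ g z = 0 := by
    refine (injective_iff_map_eq_zero _).1 (hF _ _ j hj) _ ?_
    refine (NTensor.lmap_rmap j g z).trans ?_
    rw [hz]
    exact (NTensor.rmap_exact hfg hg _).2 ⟨x, rfl⟩
  obtain ⟨w, rfl⟩ := (NTensor.rmap_exact hfg hg _).1 hz0
  rw [NTensor.lmap_rmap] at hz
  rw [← (isFlatMod_op_iff Q).1 hQ _ _ f hf hz]
  exact (NTensor.lmap_exact hjp hp _).2 ⟨w, rfl⟩

/-- A retract of a flat module is flat. -/
lemma IsFlatMod.of_retract {M F : ModuleCat.{u} S} (hF : IsFlatMod S F) (i : M →ₗ[S] F)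
    (r : F →ₗ[S] M) (hr : ∀ m, r (i m) = m) : IsFlatMod S M := by
  intro A B _ _ _ _ f hf
  have hri : r ∘ₗ i = LinearMap.id := LinearMap.ext hr
  have hinj : Function.Injective (NTensor.rmap A i) :=
    Function.LeftInverse.injective (g := NTensor.rmap A r) fun x => by
      rw [← NTensor.rmap_comp, hri, NTensor.rmap_id]
  have h := (hF A B f hf).comp hinj
  have hcomm : (NTensor.lmap F f) ∘ (NTensor.rmap A i) = (NTensor.rmap B i) ∘ (NTensor.lmap M f) :=
    funext fun x => NTensor.lmap_rmap f i x
  rw [hcomm] at h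
  exact h.of_comp

end Flat

section GorensteinFlat

variable {S : Type u} [Ring S]

lemma gflatDim_eq_zero_iff (M : ModuleCat.{u} S) : gflatDim S M = 0 ↔ IsGorensteinFlat S M := by
  constructor
  · intro h
    have hne : {d : ℕ∞ | ∃ n : ℕ, d = n ∧ gflatDimLE S n M}.Nonempty := by
      by_contra hne
      rw [Set.not_nonempty_iff_eq_empty] at hne
      rw [gflatDim, hne, sInf_empty] at h
      exact ENat.top_ne_zero h
    obtain ⟨n, hn, hM⟩ := csInf_mem hne
    have hn0 : n = 0 := by exact_mod_cast hn.symm.trans h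
    subst hn0
    exact hM
  · exact fun h => le_antisymm (sInf_le ⟨0, rfl, h⟩) zero_le

lemma gorensteinWeakGlobalDim_eq_zero_iff :
    gorensteinWeakGlobalDim S = 0 ↔ ∀ M : ModuleCat.{u} S, IsGorensteinFlat S M := by
  simp only [gorensteinWeakGlobalDim, ENat.iSup_eq_zero, gflatDim_eq_zero_iff]

/-- A total relation with total converse admits bi-infinite chains through every point. -/
lemma exists_int_chain {α : Type*} {r : α → α → Prop} (hr : ∀ x, ∃ y, r x y)
    (hl : ∀ y, ∃ x, r x y) (x : α) : ∃ Z : ℤ → α, Z 1 = x ∧ ∀ n, r (Z n) (Z (n + 1)) := by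
  choose next hnext using hr
  choose prev hprev using hl
  let Z : ℤ → α := fun n => match n with
    | Int.ofNat k => next^[k] x
    | Int.negSucc k => prev^[k + 1] x
  have hZ : ∀ n, r (Z n) (Z (n + 1)) := by
    rintro (k | k)
    · change r (next^[k] x) (next^[k + 1] x)
      rw [Function.iterate_succ_apply']
      exact hnext _
    · cases k with
      | zero => exact hprev x
      | succ k =>
        change r (prev^[k + 1 + 1] x) (prev^[k + 1] x)
        rw [Function.iterate_succ_apply' prev (k + 1)]
        exact hprev _
  refine ⟨fun n => Z (n - 1), rfl, fun n => ?_⟩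
  have h := hZ (n - 1)
  rwa [show n - 1 + 1 = n + 1 - 1 by ring] at h

open CategoryTheory in
lemma exists_injective_embedding (X : ModuleCat.{u} S) :
    ∃ (E : ModuleCat.{u} S) (i : X →ₗ[S] E), Module.Injective S E ∧ Function.Injective i := by
  obtain ⟨P⟩ := EnoughInjectives.presentation X
  exact ⟨P.J, P.f.hom, (Module.injective_iff_injective_object S P.J).2 P.injective,
    (ModuleCat.mono_iff_injective P.f).1 P.mono⟩

lemma exists_flatLink_right (h : IsLeftIF S) (X : ModuleCat.{u} S) : ∃ Y, FlatLink X Y := by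
  obtain ⟨E, i, hE, hi⟩ := exists_injective_embedding X
  exact ⟨.of S (E ⧸ LinearMap.range i), E, i, (LinearMap.range i).mkQ, hi,
    LinearMap.exact_map_mkQ_range i, Submodule.mkQ_surjective _, h E hE⟩

/-- Over an IF ring every left module is Gorenstein flat. -/
lemma isGorensteinFlat_of_IF (hl : IsLeftIF S) (hr : IsLeftIF Sᵐᵒᵖ) (M : ModuleCat.{u} S) :
    IsGorensteinFlat S M := by
  obtain ⟨Z, rfl, hZ⟩ := exists_int_chain (exists_flatLink_right hl) exists_flatLink_left M
  choose F i p hi hip hp hF using hZ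
  refine ⟨F, fun n => i (n + 1) ∘ₗ p n, hF, fun n x => ?_, ?_, fun I _ _ hI n x => ?_⟩
  · constructor
    · intro hx
      obtain ⟨y, rfl⟩ := (hip _ _).1 (hi _ (hx.trans (map_zero _).symm))
      obtain ⟨z, rfl⟩ := hp _ y
      exact ⟨z, rfl⟩
    · rintro ⟨y, rfl⟩
      exact (congrArg (i (n + 1 + 1)) ((hip _ _).2 ⟨p n y, rfl⟩)).trans (map_zero _)
  · have hrange : LinearMap.range (i (0 + 1) ∘ₗ p 0) = LinearMap.range (i (0 + 1)) :=
      LinearMap.range_comp_of_range_eq_top _ (LinearMap.range_eq_top.2 (hp 0))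
    rw [hrange]
    exact ⟨LinearEquiv.ofInjective (i 1) (hi 1)⟩
  · have hI' := isLeftIF_op_iff.1 hr I hI
    rw [NTensor.rmap_comp, map_eq_zero_iff _ (hI' _ _ _ (hi _)), NTensor.rmap_exact (hip _) (hp _)]
    constructor
    · rintro ⟨y, rfl⟩
      obtain ⟨z, rfl⟩ := NTensor.rmap_surjective (hp n) y
      exact ⟨z, NTensor.rmap_comp _ _ _⟩
    · rintro ⟨y, rfl⟩
      exact ⟨_, (NTensor.rmap_comp _ _ _).symm⟩

lemma isLeftIF_of_isGorensteinFlat (h : ∀ M : ModuleCat.{u} S, IsGorensteinFlat S M) :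
    IsLeftIF S := by
  intro E hE
  obtain ⟨F, d, hF, -, ⟨e⟩, -⟩ := h E
  let i : E →ₗ[S] F (0 + 1) := (LinearMap.range (d 0)).subtype ∘ₗ e.toLinearMap
  obtain ⟨r, hr⟩ := hE.out i (Subtype.val_injective.comp e.injective) LinearMap.id
  exact (hF _).of_retract i r hr

/-- A Gorenstein flat module `M` has a flat presentation `0 → N → F → M → 0`
that remains exact under `I ⊗_S −`, `I` injective. -/
lemma IsGorensteinFlat.exists_presentation {M : ModuleCat.{u} S} (h : IsGorensteinFlat S M) :
    ∃ (N F : ModuleCat.{u} S) (i : N →ₗ[S] F) (p : F →ₗ[S] M), IsFlatMod S F ∧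
      Function.Exact i p ∧ Function.Surjective p ∧
      ∀ (I : Type u) [AddCommGroup I] [Module Sᵐᵒᵖ I], Module.Injective Sᵐᵒᵖ I →
        Function.Injective (NTensor.rmap I i) := by
  obtain ⟨F, d, hF, hd, ⟨e⟩, hI⟩ := h
  have hd1 : Function.Exact (d (-1)) (d 0) := hd (-1)
  refine ⟨.of S (LinearMap.range (d (-1))), F 0, (LinearMap.range (d (-1))).subtype,
    e.symm.toLinearMap ∘ₗ (d 0).rangeRestrict, hF 0, ?_, ?_, ?_⟩
  · intro x
    have : (e.symm.toLinearMap ∘ₗ (d 0).rangeRestrict) x = 0 ↔ d 0 x = 0 := by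
      simp [Subtype.ext_iff]
    rw [this, hd1 x]
    simp
  · exact e.symm.surjective.comp (d 0).surjective_rangeRestrict
  · intro I _ _ hinj
    have hI2 : Function.Exact (NTensor.rmap I (d (-2))) (NTensor.rmap I (d (-1))) := hI I hinj (-2)
    have hd2 : Function.Exact (d (-2)) (d (-1)) := hd (-2)
    have hsurj := (d (-1)).surjective_rangeRestrict
    have hd2' : Function.Exact (d (-2)) (d (-1)).rangeRestrict := fun x => by
      rw [← hd2 x, Subtype.ext_iff]; rfl
    rw [injective_iff_map_eq_zero]
    intro x hx
    obtain ⟨y, rfl⟩ := NTensor.rmap_surjective (A := I) hsurj x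
    have hy := (hI2 y).1 ((NTensor.rmap_comp (d (-1)).rangeRestrict
      (LinearMap.range (d (-1))).subtype y).trans hx)
    exact (NTensor.rmap_exact hd2' hsurj y).2 hy

lemma isLeftIF_op_of_isGorensteinFlat (h : ∀ M : ModuleCat.{u} S, IsGorensteinFlat S M) :
    IsLeftIF Sᵐᵒᵖ := by
  rw [isLeftIF_op_iff]
  intro I _ _ hI K L _ _ _ _ k hk
  let q : L →ₗ[S] L ⧸ LinearMap.range k := (LinearMap.range k).mkQ
  have hkq : Function.Exact k q := LinearMap.exact_map_mkQ_range k
  have hq : Function.Surjective q := Submodule.mkQ_surjective _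
  obtain ⟨N, F, i, p, hF, hip, hp, hN⟩ := (h (.of S (L ⧸ LinearMap.range k))).exists_presentation
  have hi : ∀ n, p (i n) = 0 := fun n => (hip _).2 ⟨n, rfl⟩
  have hk0 : ∀ x, q (k x) = 0 := fun x => (hkq _).2 ⟨x, rfl⟩
  let P : Submodule S (F × L) :=
    LinearMap.ker (p ∘ₗ LinearMap.fst S F L - q ∘ₗ LinearMap.snd S F L)
  have hP : ∀ x : F × L, x ∈ P ↔ p x.1 = q x.2 := fun x => by simp [P, sub_eq_zero]
  let pF : P →ₗ[S] F := LinearMap.fst S F L ∘ₗ P.subtype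
  let pL : P →ₗ[S] L := LinearMap.snd S F L ∘ₗ P.subtype
  let iK : K →ₗ[S] P := (LinearMap.inr S F L ∘ₗ k).codRestrict P fun x => by
    rw [hP]; simpa using (hk0 x).symm
  let iN : N →ₗ[S] P := (LinearMap.inl S F L ∘ₗ i).codRestrict P fun x => by
    rw [hP]; simpa using hi x
  have hKF : Function.Exact iK pF := by
    rintro ⟨⟨a, b⟩, hab⟩
    constructor
    · intro ha
      change a = 0 at ha
      subst ha
      obtain ⟨x, rfl⟩ := (hkq b).1 (((hP _).1 hab).symm.trans (map_zero p))
      exact ⟨x, rfl⟩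
    · rintro ⟨x, hx⟩
      rw [← hx]; rfl
  have hNL : Function.Exact iN pL := by
    rintro ⟨⟨a, b⟩, hab⟩
    constructor
    · intro hb
      change b = 0 at hb
      subst hb
      obtain ⟨x, rfl⟩ := (hip a).1 (((hP _).1 hab).trans (map_zero q))
      exact ⟨x, rfl⟩
    · rintro ⟨x, hx⟩
      rw [← hx]; rfl
  have hpF : Function.Surjective pF := fun a => by
    obtain ⟨b, hb⟩ := hq (p a)
    exact ⟨⟨(a, b), (hP _).2 hb.symm⟩, rfl⟩
  have hpL : Function.Surjective pL := fun b => by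
    obtain ⟨a, ha⟩ := hp (q b)
    exact ⟨⟨(a, b), (hP _).2 ha⟩, rfl⟩
  have hiK : Function.Injective iK := fun x y hxy =>
    hk (congrArg (fun z : P => z.1.2) hxy)
  rw [injective_iff_map_eq_zero]
  intro x hx
  obtain ⟨y, hy⟩ := (NTensor.rmap_exact hNL hpL (NTensor.rmap I iK x)).1
    ((NTensor.rmap_comp iK pL x).symm.trans hx)
  have hy0 : y = 0 := by
    refine (injective_iff_map_eq_zero _).1 (hN I hI) y ?_
    refine (NTensor.rmap_comp iN pF y).trans ?_
    rw [hy]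
    exact (NTensor.rmap_exact hKF hpF _).2 ⟨x, rfl⟩
  rw [hy0, map_zero] at hy
  exact (injective_iff_map_eq_zero _).1 (rmap_injective_of_flat_cokernel I hiK hKF hpF hF) x hy.symm

lemma gorensteinWeakGlobalDim_eq_zero_iff_isLeftIF :
    gorensteinWeakGlobalDim S = 0 ↔ IsLeftIF S ∧ IsLeftIF Sᵐᵒᵖ :=
  gorensteinWeakGlobalDim_eq_zero_iff.trans
    ⟨fun h => ⟨isLeftIF_of_isGorensteinFlat h, isLeftIF_op_of_isGorensteinFlat h⟩,
      fun h => isGorensteinFlat_of_IF h.1 h.2⟩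

end GorensteinFlat

/-- **Proposition 2.9.**  For any ring `R`, the following are equivalent:
(1) `l.Gwdim(R) = 0`; (2) `R` is IF (every injective left `R`-module and every injective right
`R`-module is flat); (3) `r.Gwdim(R) = 0`. -/
theorem gorensteinWeakGlobalDim_eq_zero_iff_IF (R : Type u) [Ring R] :
    List.TFAE
      [gorensteinWeakGlobalDim R = 0,
       IsLeftIF R ∧ IsLeftIF Rᵐᵒᵖ,
       gorensteinWeakGlobalDim Rᵐᵒᵖ = 0] := by
  tfae_have 1 ↔ 2 := gorensteinWeakGlobalDim_eq_zero_iff_isLeftIF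
  tfae_have 3 ↔ 2 := by
    rw [gorensteinWeakGlobalDim_eq_zero_iff_isLeftIF, isLeftIF_opOp_iff, and_comm]
  tfae_finish
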